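/- arXiv:1810.10532 — 4 statements merged into one kernel-verified Lean document; each statement's English description precedes it below -/
import Mathlib

section
/- Let 0 < ρ < η and let g : [0,∞) → ℝ be measurable with ∫_0^∞ e^{−ρs} g(s)² ds < ∞. Then for every t ≥ 0 the integral Y(t) := ∫_t^∞ e^{−η(s−t)} g(s) ds converges absolutely, and ∫_0^∞ e^{−ρt} Y(t)² dt ≤ (1/(η(η−ρ))) ∫_0^∞ e^{−ρs} g(s)² ds; in particular ∫_0^∞ e^{−ρt} Y(t)² dt < ∞. -/
open Set MeasureTheory

section DiscountedKernel

variable {ρ η : ℝ} {g : ℝ → ℝ}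

lemma integrableOn_Ici_exp_neg_mul_sub (hη : 0 < η) (t : ℝ) :
    IntegrableOn (fun s => Real.exp (-η * (s - t))) (Ici t) := by
  have h := (integrableOn_exp_mul_Ioi (neg_lt_zero.2 hη) t).const_mul (Real.exp (η * t))
  rw [integrableOn_Ici_iff_integrableOn_Ioi]
  refine h.congr (ae_of_all _ fun s => ?_)
  simp only [← Real.exp_add]
  ring_nf

lemma integral_Ici_exp_neg_mul_sub (hη : 0 < η) (t : ℝ) :
    ∫ s in Ici t, Real.exp (-η * (s - t)) = 1 / η := by
  have h : ∀ s, Real.exp (-η * (s - t)) = Real.exp (η * t) * Real.exp (-η * s) := fun s => by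
    rw [← Real.exp_add]
    ring_nf
  simp_rw [h]
  rw [integral_const_mul, integral_Ici_eq_integral_Ioi, integral_exp_mul_Ioi (neg_lt_zero.2 hη),
    neg_div_neg_eq, ← mul_div_assoc, ← Real.exp_add]
  simp

lemma integrableOn_Ici_exp_neg_mul_sub_mul_sq (hρη : ρ ≤ η) (hg : Measurable g)
    (hint : IntegrableOn (fun s => Real.exp (-ρ * s) * (g s) ^ 2) (Ici 0)) {t : ℝ} (ht : 0 ≤ t) :
    IntegrableOn (fun s => Real.exp (-η * (s - t)) * (g s) ^ 2) (Ici t) := by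
  have h := (hint.mono_set (Ici_subset_Ici.2 ht)).const_mul (Real.exp (η * t))
  refine h.mono' (by fun_prop) ?_
  filter_upwards [ae_restrict_mem measurableSet_Ici] with s hs
  have hs0 : 0 ≤ s := ht.trans hs
  rw [Real.norm_of_nonneg (by positivity), ← mul_assoc, ← Real.exp_add]
  gcongr
  nlinarith

lemma integrableOn_Ici_exp_neg_mul_sub_mul_abs (hη : 0 < η) (hρη : ρ ≤ η) (hg : Measurable g)
    (hint : IntegrableOn (fun s => Real.exp (-ρ * s) * (g s) ^ 2) (Ici 0)) {t : ℝ} (ht : 0 ≤ t) :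
    IntegrableOn (fun s => Real.exp (-η * (s - t)) * |g s|) (Ici t) := by
  refine ((integrableOn_Ici_exp_neg_mul_sub hη t).add
    (integrableOn_Ici_exp_neg_mul_sub_mul_sq hρη hg hint ht)).mono' (by fun_prop) ?_
  refine ae_of_all _ fun s => ?_
  rw [Real.norm_of_nonneg (by positivity)]
  have h : |g s| ≤ 1 + g s ^ 2 := by
    nlinarith [sq_nonneg (|g s| - 1), sq_abs (g s), abs_nonneg (g s)]
  simpa [mul_add] using mul_le_mul_of_nonneg_left h (Real.exp_pos (-η * (s - t))).le

lemma sq_integral_Ici_exp_neg_mul_sub_mul_le (hη : 0 < η) (hρη : ρ ≤ η) (hg : Measurable g)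
    (hint : IntegrableOn (fun s => Real.exp (-ρ * s) * (g s) ^ 2) (Ici 0)) {t : ℝ} (ht : 0 ≤ t) :
    (∫ s in Ici t, Real.exp (-η * (s - t)) * g s) ^ 2 ≤
      1 / η * ∫ s in Ici t, Real.exp (-η * (s - t)) * (g s) ^ 2 := by
  have h0 := integrableOn_Ici_exp_neg_mul_sub hη t
  have h1 : IntegrableOn (fun s => Real.exp (-η * (s - t)) * g s) (Ici t) :=
    (integrableOn_Ici_exp_neg_mul_sub_mul_abs hη hρη hg hint ht).mono' (by fun_prop)
      (ae_of_all _ fun s => by simp)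
  have h2 := integrableOn_Ici_exp_neg_mul_sub_mul_sq hρη hg hint ht
  set y := ∫ s in Ici t, Real.exp (-η * (s - t)) * g s with hy
  set z := ∫ s in Ici t, Real.exp (-η * (s - t)) * (g s) ^ 2 with hz
  have key : 0 ≤ ∫ s in Ici t, (Real.exp (-η * (s - t)) * (g s) ^ 2
      - 2 * (η * y) * (Real.exp (-η * (s - t)) * g s)
      + (η * y) ^ 2 * Real.exp (-η * (s - t))) := by
    refine integral_nonneg fun s => ?_
    have := mul_nonneg (Real.exp_pos (-η * (s - t))).le (sq_nonneg (g s - η * y))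
    simp only [Pi.zero_apply]
    linarith
  have h3 : IntegrableOn (fun s => Real.exp (-η * (s - t)) * (g s) ^ 2
      - 2 * (η * y) * (Real.exp (-η * (s - t)) * g s)) (Ici t) := h2.sub (h1.const_mul _)
  rw [integral_add h3 (h0.const_mul _), integral_sub h2 (h1.const_mul _),
    integral_const_mul, integral_const_mul, integral_Ici_exp_neg_mul_sub hη, ← hy, ← hz] at key
  have e : z - 2 * (η * y) * y + (η * y) ^ 2 * (1 / η) = z - η * y ^ 2 := by
    field_simp
    ring
  rw [e] at key
  rw [one_div, ← div_eq_inv_mul, le_div_iff₀ hη]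
  linarith

/-- The integrand `e^{-ρt} e^{-η(s-t)} g(s)²` on the region `t ≤ s`, extended by zero. -/
noncomputable def discountedKernel (ρ η : ℝ) (g : ℝ → ℝ) (t s : ℝ) : ℝ :=
  if t ≤ s then Real.exp (-η * s) * (g s) ^ 2 * Real.exp ((η - ρ) * t) else 0

lemma discountedKernel_nonneg (t s : ℝ) : 0 ≤ discountedKernel ρ η g t s := by
  unfold discountedKernel
  split_ifs <;> positivity

lemma measurable_uncurry_discountedKernel (hg : Measurable g) :
    Measurable (Function.uncurry (discountedKernel ρ η g)) := by
  unfold discountedKernel Function.uncurry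
  exact Measurable.ite (measurableSet_le measurable_fst measurable_snd) (by fun_prop)
    measurable_const

lemma discountedKernel_eq_indicator_Iic (s : ℝ) :
    (fun t => discountedKernel ρ η g t s) = (Iic s).indicator
      (fun t => Real.exp (-η * s) * (g s) ^ 2 * Real.exp ((η - ρ) * t)) := by
  ext t
  simp [discountedKernel, indicator_apply]

lemma discountedKernel_eq_indicator_Ici (t : ℝ) :
    discountedKernel ρ η g t = (Ici t).indicator
      (fun s => Real.exp (-ρ * t) * (Real.exp (-η * (s - t)) * (g s) ^ 2)) := by
  ext s
  have h : Real.exp (-η * s) * (g s) ^ 2 * Real.exp ((η - ρ) * t) =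
      Real.exp (-ρ * t) * (Real.exp (-η * (s - t)) * (g s) ^ 2) := by
    rw [mul_right_comm, ← mul_assoc, ← Real.exp_add, ← Real.exp_add]
    ring_nf
  simp only [discountedKernel, indicator_apply, mem_Ici, h]

lemma integrable_discountedKernel_left (hρη : ρ < η) (s : ℝ) :
    Integrable (fun t => discountedKernel ρ η g t s) := by
  rw [discountedKernel_eq_indicator_Iic, integrable_indicator_iff measurableSet_Iic]
  exact (integrableOn_exp_mul_Iic (sub_pos.2 hρη) s).const_mul _

lemma setIntegral_Ici_discountedKernel_left_le (hρη : ρ < η) (s : ℝ) :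
    ∫ t in Ici 0, discountedKernel ρ η g t s ≤
      1 / (η - ρ) * (Real.exp (-ρ * s) * (g s) ^ 2) := by
  refine (setIntegral_le_integral (integrable_discountedKernel_left hρη s)
    (ae_of_all _ fun t => discountedKernel_nonneg t s)).trans_eq ?_
  rw [discountedKernel_eq_indicator_Iic, integral_indicator measurableSet_Iic, integral_const_mul,
    integral_exp_mul_Iic (sub_pos.2 hρη), ← mul_div_assoc, mul_right_comm, ← Real.exp_add]
  ring_nf

lemma setIntegral_Ici_discountedKernel_right {t : ℝ} (ht : 0 ≤ t) :
    ∫ s in Ici 0, discountedKernel ρ η g t s =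
      Real.exp (-ρ * t) * ∫ s in Ici t, Real.exp (-η * (s - t)) * (g s) ^ 2 := by
  rw [discountedKernel_eq_indicator_Ici, setIntegral_indicator measurableSet_Ici,
    inter_eq_right.2 (Ici_subset_Ici.2 ht), integral_const_mul]

lemma integrable_uncurry_discountedKernel (hρη : ρ < η) (hg : Measurable g)
    (hint : IntegrableOn (fun s => Real.exp (-ρ * s) * (g s) ^ 2) (Ici 0)) :
    Integrable (Function.uncurry (discountedKernel ρ η g))
      ((volume.restrict (Ici 0)).prod (volume.restrict (Ici 0))) := by
  have hm := measurable_uncurry_discountedKernel (ρ := ρ) (η := η) hg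
  rw [integrable_prod_iff' hm.aestronglyMeasurable]
  refine ⟨ae_of_all _ fun s => (integrable_discountedKernel_left hρη s).integrableOn, ?_⟩
  refine (hint.const_mul (1 / (η - ρ))).mono'
    hm.stronglyMeasurable.norm.integral_prod_left'.aestronglyMeasurable (ae_of_all _ fun s => ?_)
  simp only [Function.uncurry_apply_pair, Real.norm_of_nonneg (discountedKernel_nonneg _ _)]
  rw [Real.norm_of_nonneg (integral_nonneg fun t => discountedKernel_nonneg t s)]
  exact setIntegral_Ici_discountedKernel_left_le hρη s

lemma measurable_integral_Ici_exp_neg_mul_sub_mul (hg : Measurable g) :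
    Measurable (fun t => ∫ s in Ici t, Real.exp (-η * (s - t)) * g s) := by
  have h : Measurable (fun p : ℝ × ℝ =>
      if p.1 ≤ p.2 then Real.exp (-η * (p.2 - p.1)) * g p.2 else 0) :=
    Measurable.ite (measurableSet_le measurable_fst measurable_snd) (by fun_prop) measurable_const
  convert (h.stronglyMeasurable.integral_prod_right' (ν := volume)).measurable using 2 with t
  rw [← integral_indicator measurableSet_Ici]
  simp [indicator_apply]

end DiscountedKernel

/-- Discounted square-integrability of `Y(t) = ∫_t^∞ e^{-η(s-t)} g(s) ds`
(verification of condition (H4') in Remark 6.4 of the paper). -/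
theorem stmt_5 (ρ η : ℝ) (hρ : 0 < ρ) (hρη : ρ < η) (g : ℝ → ℝ) (hg : Measurable g)
    (hint : IntegrableOn (fun s => Real.exp (-ρ * s) * (g s) ^ 2) (Ici 0)) :
    let Y : ℝ → ℝ := fun t => ∫ s in Ici t, Real.exp (-η * (s - t)) * g s
    (∀ t, 0 ≤ t →
      IntegrableOn (fun s => Real.exp (-η * (s - t)) * |g s|) (Ici t)) ∧
    IntegrableOn (fun t => Real.exp (-ρ * t) * (Y t) ^ 2) (Ici 0) ∧
    ∫ t in Ici (0:ℝ), Real.exp (-ρ * t) * (Y t) ^ 2 ≤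
      (1 / (η * (η - ρ))) * ∫ s in Ici (0:ℝ), Real.exp (-ρ * s) * (g s) ^ 2 := by
  intro Y
  have hη : 0 < η := hρ.trans hρη
  have hK := integrable_uncurry_discountedKernel hρη hg hint
  have hbound : ∀ t ∈ Ici (0 : ℝ), Real.exp (-ρ * t) * (Y t) ^ 2 ≤
      1 / η * ∫ s in Ici 0, discountedKernel ρ η g t s := fun t ht => by
    rw [setIntegral_Ici_discountedKernel_right ht, mul_left_comm]
    exact mul_le_mul_of_nonneg_left
      (sq_integral_Ici_exp_neg_mul_sub_mul_le hη hρη.le hg hint ht) (Real.exp_pos _).le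
  have hKint : IntegrableOn (fun t => 1 / η * ∫ s in Ici 0, discountedKernel ρ η g t s) (Ici 0) :=
    hK.integral_prod_left.const_mul _
  have hYm : Measurable Y := measurable_integral_Ici_exp_neg_mul_sub_mul hg
  have hY : IntegrableOn (fun t => Real.exp (-ρ * t) * (Y t) ^ 2) (Ici 0) := by
    refine hKint.mono' (by fun_prop) ?_
    filter_upwards [ae_restrict_mem measurableSet_Ici] with t ht
    rw [Real.norm_of_nonneg (by positivity)]
    exact hbound t ht
  refine ⟨fun t ht => integrableOn_Ici_exp_neg_mul_sub_mul_abs hη hρη.le hg hint ht, hY, ?_⟩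
  calc ∫ t in Ici (0:ℝ), Real.exp (-ρ * t) * (Y t) ^ 2
      ≤ ∫ t in Ici 0, 1 / η * ∫ s in Ici 0, discountedKernel ρ η g t s :=
        setIntegral_mono_on hY hKint measurableSet_Ici hbound
    _ = 1 / η * ∫ s in Ici 0, ∫ t in Ici 0, discountedKernel ρ η g t s := by
        rw [integral_const_mul, integral_integral_swap hK]
    _ ≤ 1 / η * ∫ s in Ici 0, 1 / (η - ρ) * (Real.exp (-ρ * s) * (g s) ^ 2) :=
        mul_le_mul_of_nonneg_left
          (integral_mono hK.integral_prod_right (hint.const_mul _)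
            (setIntegral_Ici_discountedKernel_left_le hρη)) (by positivity)
    _ = (1 / (η * (η - ρ))) * ∫ s in Ici (0:ℝ), Real.exp (-ρ * s) * (g s) ^ 2 := by
        rw [integral_const_mul, ← mul_assoc, one_div_mul_one_div]
end

section
/- Let Q̂ be a d×d real symmetric matrix, K a d×d real symmetric matrix, D̂ a d×d real matrix, F̂ a d×m real matrix, Î an m×d real matrix, and N̂ an m×m real symmetric positive definite matrix; assume N̂ + F̂ᵀKF̂ is invertible, and set M := D̂ − F̂N̂⁻¹Î. Then (Q̂ + D̂ᵀKD̂) − (Î + F̂ᵀKD̂)ᵀ(N̂ + F̂ᵀKF̂)⁻¹(Î + F̂ᵀKD̂) = (Q̂ − ÎᵀN̂⁻¹Î) + MᵀKM − (F̂ᵀKM)ᵀ(N̂ + F̂ᵀKF̂)⁻¹(F̂ᵀKM). -/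
open Matrix

/-- Completing the square: the Schur-type quadratic term at `S * J + G`. -/
theorem Matrix.transpose_mul_inv_mul_completeSquare {n p R : Type*} [Fintype n] [DecidableEq n]
    [CommRing R] {S : Matrix n n R} (hS : S.IsSymm) (hu : IsUnit S) (J G : Matrix n p R) :
    (S * J + G)ᵀ * S⁻¹ * (S * J + G) = Jᵀ * S * J + Jᵀ * G + Gᵀ * J + Gᵀ * S⁻¹ * G := by
  have hdet : IsUnit S.det := (Matrix.isUnit_iff_isUnit_det S).mp hu
  have h : (S * J + G)ᵀ * S⁻¹ = Jᵀ + Gᵀ * S⁻¹ := by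
    rw [transpose_add, transpose_mul, hS.eq, Matrix.add_mul,
      Matrix.mul_nonsing_inv_cancel_right _ _ hdet]
  rw [h, Matrix.add_mul, Matrix.mul_add, Matrix.mul_add, ← Matrix.mul_assoc (Gᵀ * S⁻¹),
    Matrix.nonsing_inv_mul_cancel_right _ _ hdet, ← Matrix.mul_assoc]
  abel

/-- Algebraic identity for shifted Riccati data (Step 3(ii), Section 4). -/
theorem stmt_9 {d m : ℕ} (Qh K : Matrix (Fin d) (Fin d) ℝ)
    (hQ : Qh.IsSymm) (hK : K.IsSymm)
    (Dh : Matrix (Fin d) (Fin d) ℝ) (Fh : Matrix (Fin d) (Fin m) ℝ)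
    (Ih : Matrix (Fin m) (Fin d) ℝ) (Nh : Matrix (Fin m) (Fin m) ℝ)
    (hN : Nh.PosDef) (hInv : IsUnit (Nh + Fhᵀ * K * Fh)) :
    let M := Dh - Fh * Nh⁻¹ * Ih
    (Qh + Dhᵀ * K * Dh) -
        (Ih + Fhᵀ * K * Dh)ᵀ * (Nh + Fhᵀ * K * Fh)⁻¹ * (Ih + Fhᵀ * K * Dh) =
      (Qh - Ihᵀ * Nh⁻¹ * Ih) + Mᵀ * K * M -
        (Fhᵀ * K * M)ᵀ * (Nh + Fhᵀ * K * Fh)⁻¹ * (Fhᵀ * K * M) := by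
  intro M
  have hNsymm : Nhᵀ = Nh := by simpa using hN.isHermitian.eq
  have hNdet : IsUnit Nh.det := (Matrix.isUnit_iff_isUnit_det Nh).mp hN.isUnit
  obtain ⟨J, rfl⟩ : ∃ J, Ih = Nh * J :=
    ⟨Nh⁻¹ * Ih, (Matrix.mul_nonsing_inv_cancel_left _ _ hNdet).symm⟩
  have hM : Dh = M + Fh * J := by
    simp only [M, Matrix.mul_assoc, Matrix.nonsing_inv_mul_cancel_left _ _ hNdet, sub_add_cancel]
  clear_value M
  subst hM
  have hS : (Nh + Fhᵀ * K * Fh).IsSymm := by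
    simp [Matrix.IsSymm, hNsymm, hK.eq, Matrix.mul_assoc]
  have hG : Nh * J + Fhᵀ * K * (M + Fh * J) = (Nh + Fhᵀ * K * Fh) * J + Fhᵀ * K * M := by
    simp only [Matrix.add_mul, Matrix.mul_add, Matrix.mul_assoc]
    abel
  rw [hG, transpose_mul_inv_mul_completeSquare hS hInv]
  have hGt : (Fhᵀ * K * M)ᵀ = Mᵀ * K * Fh := by
    simp [hK.eq, Matrix.mul_assoc]
  rw [hGt]
  simp only [transpose_mul, transpose_add, hNsymm, Matrix.add_mul, Matrix.mul_add,
    Matrix.mul_assoc, Matrix.nonsing_inv_mul_cancel_left _ _ hNdet]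
  abel
end

section
/- Let σ > 0, ρ > σ², and let δ, η ≥ 0 with δ > 0, c > 0, x₀ > 0, ε > 0. Define K_η := (−(ρ−σ²) + √((ρ−σ²)² + 2(ρ−σ²)c/(x₀(δ+η))))/2 and K := (δ+η)K_η − c/(2x₀); further define Λ_ε := (−ρ + √(ρ² + 4(ρ(c+εx₀)/(2x₀) + σ²K)/δ))/2 and Λ := δΛ_ε − (c+εx₀)/(2x₀). Then K_η > 0, Λ_ε > 0, −c/(2x₀) < K ≤ 0, and the pair (K, Λ) solves the system (K + c/(2x₀))²/(δ+η) + (ρ−σ²)K = 0 and (Λ + (c+εx₀)/(2x₀))²/δ + ρΛ − σ²K = 0. Moreover, K_η is the unique positive real root of z² + (ρ−σ²)z = (ρ−σ²)c/(2x₀(δ+η)), and Λ_ε is the unique positive real root of z² + ρz = (ρ(c+εx₀)/(2x₀) + σ²K)/δ. -/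
/-- The larger root of `z ^ 2 + a * z = b` for positive `a` and `b` is its only positive root. -/
theorem quadratic_pos_root {a b D : ℝ} (ha : 0 < a) (hb : 0 < b) (hD : D = a ^ 2 + 4 * b) :
    0 < (-a + √D) / 2 ∧
      ((-a + √D) / 2) ^ 2 + a * ((-a + √D) / 2) = b ∧
      ∀ z : ℝ, 0 < z → z ^ 2 + a * z = b → z = (-a + √D) / 2 := by
  have hpos : 0 < (-a + √D) / 2 := by
    have : a < √D := Real.lt_sqrt_of_sq_lt (by linarith)
    linarith
  have hroot : ((-a + √D) / 2) ^ 2 + a * ((-a + √D) / 2) = b := by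
    have := Real.sq_sqrt (show 0 ≤ D by rw [hD]; positivity)
    linear_combination (this + hD) / 4
  refine ⟨hpos, hroot, fun z hz hzb => ?_⟩
  have hfactor : (z - (-a + √D) / 2) * (z + (-a + √D) / 2 + a) = 0 := by
    linear_combination hzb - hroot
  rcases mul_eq_zero.mp hfactor with h | h <;> linarith


/-- Explicit solution of the stationary Riccati system (7.2) in the
exhaustible-resource application (Section 7 of the paper). -/
theorem stmt_13 (σ ρ δ η c x₀ ε : ℝ)
    (hσ : 0 < σ) (hρ : σ ^ 2 < ρ) (hδ : 0 < δ) (hη : 0 ≤ η)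
    (hc : 0 < c) (hx₀ : 0 < x₀) (hε : 0 < ε) :
    let Kη : ℝ := (-(ρ - σ ^ 2) +
      Real.sqrt ((ρ - σ ^ 2) ^ 2 + 2 * (ρ - σ ^ 2) * c / (x₀ * (δ + η)))) / 2
    let K : ℝ := (δ + η) * Kη - c / (2 * x₀)
    let Λε : ℝ := (-ρ +
      Real.sqrt (ρ ^ 2 + 4 * (ρ * (c + ε * x₀) / (2 * x₀) + σ ^ 2 * K) / δ)) / 2
    let Λ : ℝ := δ * Λε - (c + ε * x₀) / (2 * x₀)
    0 < Kη ∧ 0 < Λε ∧ (-c / (2 * x₀) < K ∧ K ≤ 0) ∧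
    ((K + c / (2 * x₀)) ^ 2 / (δ + η) + (ρ - σ ^ 2) * K = 0) ∧
    ((Λ + (c + ε * x₀) / (2 * x₀)) ^ 2 / δ + ρ * Λ - σ ^ 2 * K = 0) ∧
    (∀ z : ℝ, 0 < z →
      z ^ 2 + (ρ - σ ^ 2) * z = (ρ - σ ^ 2) * c / (2 * x₀ * (δ + η)) → z = Kη) ∧
    (∀ z : ℝ, 0 < z →
      z ^ 2 + ρ * z = (ρ * (c + ε * x₀) / (2 * x₀) + σ ^ 2 * K) / δ → z = Λε) := by
  intro Kη K Λε Λ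
  have ha : 0 < ρ - σ ^ 2 := sub_pos.mpr hρ
  have hρ_pos : 0 < ρ := (sq_nonneg σ).trans_lt hρ
  have hs : 0 < δ + η := by linarith
  have hb : 0 < (ρ - σ ^ 2) * c / (2 * x₀ * (δ + η)) := by positivity
  obtain ⟨hKη, hKη_root, hKη_unique⟩ := quadratic_pos_root ha hb
    (D := (ρ - σ ^ 2) ^ 2 + 2 * (ρ - σ ^ 2) * c / (x₀ * (δ + η))) (by field_simp; ring)
  change 0 < Kη at hKη
  change Kη ^ 2 + (ρ - σ ^ 2) * Kη = _ at hKη_root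
  have hK : K = (δ + η) * Kη - c / (2 * x₀) := rfl
  have hKη_scaled : (δ + η) * Kη ^ 2 + (ρ - σ ^ 2) * K = 0 := by
    have h : (δ + η) * ((ρ - σ ^ 2) * c / (2 * x₀ * (δ + η))) =
        (ρ - σ ^ 2) * (c / (2 * x₀)) := by field_simp
    rw [hK]
    linear_combination (δ + η) * hKη_root + h
  have hK_lower : -c / (2 * x₀) < K := by
    have : 0 < (δ + η) * Kη := mul_pos hs hKη
    rw [hK, neg_div]
    linarith
  have hK_nonpos : K ≤ 0 := by
    have : 0 < (δ + η) * Kη ^ 2 := by positivity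
    exact nonpos_of_mul_nonpos_right (by linarith) ha
  have hd : 0 < (ρ * (c + ε * x₀) / (2 * x₀) + σ ^ 2 * K) / δ := by
    refine div_pos ?_ hδ
    have h₁ : 0 < σ ^ 2 * (K - -c / (2 * x₀)) := mul_pos (by positivity) (sub_pos.mpr hK_lower)
    have h₂ : 0 < (ρ - σ ^ 2) * c / (2 * x₀) + ρ * ε / 2 := by positivity
    have h₃ : ρ * (c + ε * x₀) / (2 * x₀) + σ ^ 2 * K =
        σ ^ 2 * (K - -c / (2 * x₀)) + ((ρ - σ ^ 2) * c / (2 * x₀) + ρ * ε / 2) := by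
      field_simp
      ring
    linarith
  obtain ⟨hΛε, hΛε_root, hΛε_unique⟩ := quadratic_pos_root hρ_pos hd
    (D := ρ ^ 2 + 4 * (ρ * (c + ε * x₀) / (2 * x₀) + σ ^ 2 * K) / δ) (by ring)
  change Λε ^ 2 + ρ * Λε = _ at hΛε_root
  have hΛ : Λ = δ * Λε - (c + ε * x₀) / (2 * x₀) := rfl
  refine ⟨hKη, hΛε, ⟨hK_lower, hK_nonpos⟩, ?_, ?_, hKη_unique, hΛε_unique⟩
  · have h : (K + c / (2 * x₀)) ^ 2 / (δ + η) = (δ + η) * Kη ^ 2 := by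
      rw [hK, sub_add_cancel]
      field_simp
    rw [h, hKη_scaled]
  · have h : (Λ + (c + ε * x₀) / (2 * x₀)) ^ 2 / δ = δ * Λε ^ 2 := by
      rw [hΛ, sub_add_cancel]
      field_simp
    rw [eq_div_iff hδ.ne'] at hΛε_root
    rw [h, hΛ]
    linear_combination hΛε_root
end

section
/- Let σ > 0, ρ > σ², δ > 0, c > 0, x₀ > 0, ε > 0, and p̄ < c + εx₀. For η ≥ 0 define K_η := (−(ρ−σ²) + √((ρ−σ²)² + 2(ρ−σ²)c/(x₀(δ+η))))/2 and x̄_∞(η) := ρ(c + εx₀ − p̄) / (ρε + ((K_η+ρ)/(K_η+ρ−σ²))·(ρ−σ²)·c/x₀). Then the function η ↦ x̄_∞(η) is strictly decreasing on [0,∞), x̄_∞(η) > 0 for all η ≥ 0, and x̄_∞(η) → x₀(1 − p̄/(c+εx₀)) as η → ∞. -/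
open Set Filter

/-- The function `t ↦ (-a + √(a ^ 2 + b / (x * (d + t)))) / 2` is strictly decreasing on
`[0, ∞)`. -/
lemma strictAntiOn_neg_add_sqrt_div_two {a b x d : ℝ} (hb : 0 < b) (hx : 0 < x) (hd : 0 < d) :
    StrictAntiOn (fun t : ℝ => (-a + Real.sqrt (a ^ 2 + b / (x * (d + t)))) / 2) (Ici 0) := by
  intro s hs t _ hst
  have hs : 0 ≤ s := hs
  have hlt : b / (x * (d + t)) < b / (x * (d + s)) := by gcongr
  have ht : 0 ≤ b / (x * (d + t)) := by
    have : 0 < d + t := by linarith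
    positivity
  have : Real.sqrt (a ^ 2 + b / (x * (d + t))) < Real.sqrt (a ^ 2 + b / (x * (d + s))) :=
    Real.sqrt_lt_sqrt (by positivity) (by linarith)
  dsimp only
  linarith

lemma neg_add_sqrt_div_two_nonneg {a y : ℝ} (hy : 0 ≤ y) :
    0 ≤ (-a + Real.sqrt (a ^ 2 + y)) / 2 := by
  have : a ≤ Real.sqrt (a ^ 2 + y) := Real.le_sqrt_of_sq_le (by linarith)
  linarith

lemma tendsto_neg_add_sqrt_div_two {a b x d : ℝ} (ha : 0 ≤ a) (hx : 0 < x) :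
    Tendsto (fun t : ℝ => (-a + Real.sqrt (a ^ 2 + b / (x * (d + t)))) / 2) atTop (nhds 0) := by
  have hlim : Tendsto (fun t : ℝ => b / (x * (d + t))) atTop (nhds 0) :=
    ((tendsto_atTop_add_const_left _ d tendsto_id).const_mul_atTop hx).const_div_atTop b
  have hcont : Continuous fun y : ℝ => (-a + Real.sqrt (a ^ 2 + y)) / 2 := by fun_prop
  have h := (hcont.tendsto 0).comp hlim
  simpa [Real.sqrt_sq ha, Function.comp_def] using h

lemma strictAntiOn_add_div_add_sub {r s : ℝ} (hs : 0 < s) (hr : s < r) :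
    StrictAntiOn (fun k : ℝ => (k + r) / (k + r - s)) (Ici 0) := by
  intro k hk l hl hkl
  have hk : 0 ≤ k := hk
  have hl : 0 ≤ l := hl
  dsimp only
  rw [div_lt_div_iff₀ (by linarith) (by linarith)]
  nlinarith

/-- Sensitivity of the long-run average reserve level `x̄_∞` with respect to the
intermittence parameter `η` (Section 7 of the paper). -/
theorem stmt_15 (σ ρ δ c x₀ ε pbar : ℝ)
    (hσ : 0 < σ) (hρ : σ ^ 2 < ρ) (hδ : 0 < δ)
    (hc : 0 < c) (hx₀ : 0 < x₀) (hε : 0 < ε) (hp : pbar < c + ε * x₀) :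
    let Kη : ℝ → ℝ := fun η =>
      (-(ρ - σ ^ 2) +
        Real.sqrt ((ρ - σ ^ 2) ^ 2 + 2 * (ρ - σ ^ 2) * c / (x₀ * (δ + η)))) / 2
    let xinf : ℝ → ℝ := fun η =>
      ρ * (c + ε * x₀ - pbar) /
        (ρ * ε + ((Kη η + ρ) / (Kη η + ρ - σ ^ 2)) * (ρ - σ ^ 2) * c / x₀)
    StrictAntiOn xinf (Ici 0) ∧ (∀ η, 0 ≤ η → 0 < xinf η) ∧
    Tendsto xinf atTop (nhds (x₀ * (1 - pbar / (c + ε * x₀)))) := by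
  intro Kη xinf
  have ha : 0 < ρ - σ ^ 2 := by linarith
  have hσ2 : 0 < σ ^ 2 := by positivity
  have hρ0 : 0 < ρ := by linarith
  have hH : 0 < c + ε * x₀ - pbar := by linarith
  have hK : ∀ η, 0 ≤ η → 0 ≤ Kη η := fun η hη =>
    neg_add_sqrt_div_two_nonneg (by positivity)
  have hKanti : StrictAntiOn Kη (Ici 0) :=
    strictAntiOn_neg_add_sqrt_div_two (by positivity) hx₀ hδ
  have hden : ∀ η, 0 ≤ η →
      0 < ρ * ε + ((Kη η + ρ) / (Kη η + ρ - σ ^ 2)) * (ρ - σ ^ 2) * c / x₀ := by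
    intro η hη
    have h0 := hK η hη
    have h1 : 0 < Kη η + ρ - σ ^ 2 := by linarith
    positivity
  refine ⟨?_, fun η hη => div_pos (by positivity) (hden η hη), ?_⟩
  · intro s hs t ht hst
    have hratio := strictAntiOn_add_div_add_sub hσ2 hρ (hK t ht) (hK s hs) (hKanti hs ht hst)
    dsimp only at hratio
    exact div_lt_div_of_pos_left (by positivity) (hden s hs) (by gcongr)
  · have hKlim : Tendsto Kη atTop (nhds 0) := tendsto_neg_add_sqrt_div_two ha.le hx₀
    have hKρ : Tendsto (fun η => Kη η + ρ) atTop (nhds ρ) := by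
      simpa using hKlim.add_const ρ
    have hlim := ((((hKρ.div (hKρ.sub_const (σ ^ 2)) ha.ne').mul_const (ρ - σ ^ 2)).mul_const
      c).div_const x₀).const_add (ρ * ε)
    have hval : ρ * ε + ρ / (ρ - σ ^ 2) * (ρ - σ ^ 2) * c / x₀ = ρ * (c + ε * x₀) / x₀ := by
      field_simp
      ring
    rw [hval] at hlim
    have hfin := (tendsto_const_nhds (x := ρ * (c + ε * x₀ - pbar))).div hlim (by positivity)
    have hval' : ρ * (c + ε * x₀ - pbar) / (ρ * (c + ε * x₀) / x₀) =
        x₀ * (1 - pbar / (c + ε * x₀)) := by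
      have : c + ε * x₀ ≠ 0 := by positivity
      field_simp
    rw [hval'] at hfin
    exact hfin
end
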